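/- Let (X₀, X₁)_X be a pair of compatible metric spaces with X₀ ∩ X₁ ≠ ∅, let θ ∈ (0, 1) and q ∈ [1, ∞], and let p ∈ [1, ∞] be the conjugate exponent of q (1/p + 1/q = 1). Then for all x, y ∈ X₀ ∩ X₁, K_M(1; x, y) ≤ M'_{θ,q} · p_{θ,q}(x, y), where M'_{θ,q} := (Σ_{j∈ℤ} (2^{jθ}·min{1, 2^{-j}})^p)^{1/p} (with the obvious supremum modification if p = ∞) is a finite positive constant. -/

import Mathlib

open scoped ENNReal Classical

/-- A function `d` is a metric on the subset `A` of `X`. -/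
structure IsMetricOn {X : Type*} (d : X → X → ℝ) (A : Set X) : Prop where
  refl : ∀ x ∈ A, d x x = 0
  eq_of_dist_eq_zero : ∀ x ∈ A, ∀ y ∈ A, d x y = 0 → x = y
  symm : ∀ x ∈ A, ∀ y ∈ A, d x y = d y x
  triangle : ∀ x ∈ A, ∀ y ∈ A, ∀ z ∈ A, d x z ≤ d x y + d y z

/-- A pair of compatible metric spaces `(X₀, X₁)_X` inside an ambient metric space `X`. -/
structure CompatiblePair (X : Type*) [MetricSpace X] where
  X0 : Set X
  X1 : Set X
  d0 : X → X → ℝ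
  d1 : X → X → ℝ
  inter_nonempty : (X0 ∩ X1).Nonempty
  met0 : IsMetricOn d0 X0
  met1 : IsMetricOn d1 X1
  C0 : ℝ
  C1 : ℝ
  C0_pos : 0 < C0
  C1_pos : 0 < C1
  compat0 : ∀ x ∈ X0, ∀ y ∈ X0, dist x y ≤ C0 * d0 x y
  compat1 : ∀ x ∈ X1, ∀ y ∈ X1, dist x y ≤ C1 * d1 x y

namespace CompatiblePair

variable {X : Type*} [MetricSpace X] (P : CompatiblePair X)

/-- The `J_M` functional: `J_M(t; x, y) = max {d₀(x,y), t·d₁(x,y)}`. -/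
noncomputable def JM (t : ℝ) (x y : X) : ℝ := max (P.d0 x y) (t * P.d1 x y)

/-- The cost function `h_t` on pairs in `X₀² ∪ X₁²`. -/
noncomputable def hFun (t : ℝ) (x y : X) : ℝ :=
  if x ∈ P.X0 ∩ P.X1 ∧ y ∈ P.X0 ∩ P.X1 then min (P.d0 x y) (t * P.d1 x y)
  else if x ∈ P.X0 ∧ y ∈ P.X0 then P.d0 x y
  else t * P.d1 x y

/-- `f 0 = x, …, f n = y` is an admissible linking sequence from `x` to `y` in `X₀ ∪ X₁`. -/
def IsAdmissibleChain (x y : X) (n : ℕ) (f : ℕ → X) : Prop :=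
  f 0 = x ∧ f n = y ∧ (∀ k ≤ n, f k ∈ P.X0 ∪ P.X1) ∧
    ∀ k < n, (f k ∈ P.X0 ∧ f (k + 1) ∈ P.X0) ∨ (f k ∈ P.X1 ∧ f (k + 1) ∈ P.X1)

/-- The `K_M` functional: infimum of `∑ h_t` over admissible linking sequences. -/
noncomputable def KM (t : ℝ) (x y : X) : ℝ :=
  sInf { s : ℝ | ∃ n f, P.IsAdmissibleChain x y n f ∧
    s = ∑ k ∈ Finset.range n, P.hFun t (f k) (f (k + 1)) }

end CompatiblePair

/-- The functional `Γ_{θ,q}` of a bi-infinite real sequence, valued in `[0,∞]`. -/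
noncomputable def GammaE (θ : ℝ) (q : ℝ≥0∞) (x : ℤ → ℝ) : ℝ≥0∞ :=
  if q = ∞ then ⨆ k : ℤ, ENNReal.ofReal ((2 : ℝ) ^ (-(k : ℝ) * θ) * |x k|)
  else (∑' k : ℤ, ENNReal.ofReal ((2 : ℝ) ^ (-(k : ℝ) * θ) * |x k|) ^ q.toReal) ^ (1 / q.toReal)

/-- The real-valued functional `Γ_{θ,q}`. -/
noncomputable def Gamma (θ : ℝ) (q : ℝ≥0∞) (x : ℤ → ℝ) : ℝ := (GammaE θ q x).toReal

/-- The constant `M_{θ,q} = Γ_{θ,q}((min{1, 2^k})_k)`. -/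
noncomputable def MThetaQ (θ : ℝ) (q : ℝ≥0∞) : ℝ :=
  Gamma θ q (fun k : ℤ => min 1 ((2 : ℝ) ^ k))

/-- The constant `M'_{θ,q} = (∑_j (2^{jθ} min{1,2^{-j}})^p)^{1/p}` (with `p` the
conjugate exponent of `q`, and the supremum modification for `p = ∞`). -/
noncomputable def MConst' (θ : ℝ) (p : ℝ≥0∞) : ℝ :=
  (if p = ∞ then ⨆ j : ℤ, ENNReal.ofReal ((2 : ℝ) ^ ((j : ℝ) * θ) * min 1 ((2 : ℝ) ^ (-(j : ℝ))))
   else (∑' j : ℤ,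
      ENNReal.ofReal ((2 : ℝ) ^ ((j : ℝ) * θ) * min 1 ((2 : ℝ) ^ (-(j : ℝ)))) ^ p.toReal) ^
        (1 / p.toReal)).toReal

/-- The `ℓ^q` norm of a bi-infinite real sequence, valued in `[0,∞]`. -/
noncomputable def lqNorm (q : ℝ≥0∞) (c : ℤ → ℝ) : ℝ≥0∞ :=
  if q = ∞ then ⨆ k : ℤ, ENNReal.ofReal |c k|
  else (∑' k : ℤ, ENNReal.ofReal |c k| ^ q.toReal) ^ (1 / q.toReal)

namespace CompatiblePair

variable {X : Type*} [MetricSpace X] (P : CompatiblePair X)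

/-- The metric `β_{θ,q}(x,y) = Γ_{θ,q}((K_M(2^k; x, y))_k)` on `X₀ ∩ X₁`. -/
noncomputable def beta (θ : ℝ) (q : ℝ≥0∞) (x y : X) : ℝ :=
  Gamma θ q (fun k : ℤ => P.KM ((2 : ℝ) ^ k) x y)

/-- `u` is an approximating sequence of `x` in `(X₀ ∩ X₁, J_M(1))`: a sequence in
`X₀ ∩ X₁`, Cauchy for `J_M(1)`, with `K_M(1; uₙ, x) → 0`. -/
def IsApproxSeq (x : X) (u : ℕ → X) : Prop :=
  (∀ n, u n ∈ P.X0 ∩ P.X1) ∧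
  (∀ ε > 0, ∃ N, ∀ m ≥ N, ∀ n ≥ N, P.JM 1 (u m) (u n) < ε) ∧
  Filter.Tendsto (fun n => P.KM 1 (u n) x) Filter.atTop (nhds 0)

/-- The bi-infinite linking sequence `S_k = u_k` for `k ≥ 0`, `S_k = v_{-k}` for `k < 0`. -/
noncomputable def linkSeq (u v : ℕ → X) : ℤ → X :=
  fun k => if 0 ≤ k then u k.toNat else v (-k).toNat

/-- The functional `p_{θ,q}` valued in `[0,∞]`: infimum of
`Γ_{θ,q}((J_M(2^k; S_k, S_{k+1}))_k)` over approximating sequences of `x` and `y`. -/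
noncomputable def pFunE (θ : ℝ) (q : ℝ≥0∞) (x y : X) : ℝ≥0∞ :=
  ⨅ (u : ℕ → X) (v : ℕ → X) (_ : P.IsApproxSeq x u) (_ : P.IsApproxSeq y v),
    GammaE θ q (fun k : ℤ =>
      P.JM ((2 : ℝ) ^ k) (linkSeq u v k) (linkSeq u v (k + 1)))

/-- The real-valued functional `p_{θ,q}`. -/
noncomputable def pFun (θ : ℝ) (q : ℝ≥0∞) (x y : X) : ℝ := (P.pFunE θ q x y).toReal

/-- The symmetrization `P_{θ,q}(x,y) = (p_{θ,q}(x,y) + p_{θ,q}(y,x))/2`. -/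
noncomputable def PFun (θ : ℝ) (q : ℝ≥0∞) (x y : X) : ℝ :=
  (P.pFun θ q x y + P.pFun θ q y x) / 2

/-- The metric `δ_{θ,q}`: infimum of `∑ P_{θ,q}` over finite chains in `X₀ ∩ X₁`. -/
noncomputable def delta (θ : ℝ) (q : ℝ≥0∞) (x y : X) : ℝ :=
  sInf { s : ℝ | ∃ (n : ℕ) (f : ℕ → X), f 0 = x ∧ f n = y ∧
    (∀ k ≤ n, f k ∈ P.X0 ∩ P.X1) ∧
    s = ∑ j ∈ Finset.range n, P.PFun θ q (f j) (f (j + 1)) }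

end CompatiblePair

namespace CompatiblePair

variable {X : Type*} [MetricSpace X] (P : CompatiblePair X)

lemma d0_nonneg {x y : X} (hx : x ∈ P.X0) (hy : y ∈ P.X0) : 0 ≤ P.d0 x y :=
  nonneg_of_mul_nonneg_right (dist_nonneg.trans (P.compat0 x hx y hy)) P.C0_pos

lemma d1_nonneg {x y : X} (hx : x ∈ P.X1) (hy : y ∈ P.X1) : 0 ≤ P.d1 x y :=
  nonneg_of_mul_nonneg_right (dist_nonneg.trans (P.compat1 x hx y hy)) P.C1_pos

/-- The pairs on which the cost `h_t` is considered, i.e. `X₀² ∪ X₁²`. -/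
def Linked (x y : X) : Prop := (x ∈ P.X0 ∧ y ∈ P.X0) ∨ (x ∈ P.X1 ∧ y ∈ P.X1)

lemma Linked.symm {P : CompatiblePair X} {x y : X} (h : P.Linked x y) : P.Linked y x :=
  h.imp And.symm And.symm

lemma hFun_nonneg {t : ℝ} (ht : 0 ≤ t) {x y : X} (h : P.Linked x y) : 0 ≤ P.hFun t x y := by
  unfold hFun
  split_ifs with hxy h0
  · exact le_min (P.d0_nonneg hxy.1.1 hxy.2.1) (mul_nonneg ht (P.d1_nonneg hxy.1.2 hxy.2.2))
  · exact P.d0_nonneg h0.1 h0.2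
  · have h1 := h.resolve_left h0
    exact mul_nonneg ht (P.d1_nonneg h1.1 h1.2)

lemma hFun_symm (t : ℝ) {x y : X} (h : P.Linked x y) : P.hFun t x y = P.hFun t y x := by
  unfold hFun
  by_cases hxy : x ∈ P.X0 ∩ P.X1 ∧ y ∈ P.X0 ∩ P.X1
  · rw [if_pos hxy, if_pos hxy.symm, P.met0.symm x hxy.1.1 y hxy.2.1,
      P.met1.symm x hxy.1.2 y hxy.2.2]
  rw [if_neg hxy, if_neg (mt And.symm hxy)]
  by_cases h0 : x ∈ P.X0 ∧ y ∈ P.X0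
  · rw [if_pos h0, if_pos h0.symm, P.met0.symm x h0.1 y h0.2]
  · have h1 := h.resolve_left h0
    rw [if_neg h0, if_neg (mt And.symm h0), P.met1.symm x h1.1 y h1.2]

/-- The costs of the admissible linking sequences from `x` to `y`. -/
def chainCosts (t : ℝ) (x y : X) : Set ℝ :=
  { s : ℝ | ∃ n f, P.IsAdmissibleChain x y n f ∧
    s = ∑ k ∈ Finset.range n, P.hFun t (f k) (f (k + 1)) }

lemma nonneg_of_mem_chainCosts {t : ℝ} (ht : 0 ≤ t) {x y : X} {s : ℝ}
    (hs : s ∈ P.chainCosts t x y) : 0 ≤ s := by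
  obtain ⟨n, f, hf, rfl⟩ := hs
  exact Finset.sum_nonneg fun k hk => P.hFun_nonneg ht (hf.2.2.2 k (Finset.mem_range.1 hk))

lemma chainCosts_bddBelow {t : ℝ} (ht : 0 ≤ t) (x y : X) : BddBelow (P.chainCosts t x y) :=
  ⟨0, fun _ hs => P.nonneg_of_mem_chainCosts ht hs⟩

lemma hFun_mem_chainCosts (t : ℝ) {x y : X} (h : P.Linked x y) :
    P.hFun t x y ∈ P.chainCosts t x y := by
  refine ⟨1, fun k => if k = 0 then x else y, ⟨by simp, by simp, ?_, ?_⟩, by simp⟩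
  · intro k _
    rcases h with h | h <;> by_cases hk : k = 0 <;> simp [hk, h.1, h.2]
  · intro k hk
    obtain rfl : k = 0 := by omega
    simpa [Linked] using h

lemma chainCosts_symm_subset (t : ℝ) (x y : X) : P.chainCosts t x y ⊆ P.chainCosts t y x := by
  rintro _ ⟨n, f, ⟨h0, hn, hmem, hlink⟩, rfl⟩
  refine ⟨n, fun k => f (n - k), ⟨by simpa using hn, by simpa using h0,
    fun k _ => hmem _ (Nat.sub_le _ _), fun k hk => ?_⟩, ?_⟩
  · have h : P.Linked _ _ := hlink (n - (k + 1)) (by omega)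
    rw [show n - (k + 1) + 1 = n - k by omega] at h
    exact h.symm
  · rw [← Finset.sum_range_reflect]
    refine Finset.sum_congr rfl fun k hk => ?_
    have hk := Finset.mem_range.1 hk
    have h : P.Linked _ _ := hlink (n - 1 - k) (by omega)
    rw [P.hFun_symm t h, show n - 1 - k + 1 = n - k by omega,
      show n - 1 - k = n - (k + 1) by omega]

lemma add_mem_chainCosts {t : ℝ} {x y z : X} {a b : ℝ} (ha : a ∈ P.chainCosts t x y)
    (hb : b ∈ P.chainCosts t y z) : a + b ∈ P.chainCosts t x z := by
  obtain ⟨n, f, ⟨f0, fn, fmem, flink⟩, rfl⟩ := ha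
  obtain ⟨m, g, ⟨g0, gm, gmem, glink⟩, rfl⟩ := hb
  set c : ℕ → X := fun k => if k ≤ n then f k else g (k - n) with hc
  have hcf : ∀ k ≤ n, c k = f k := fun k hk => if_pos hk
  have hcg : ∀ k, c (n + k) = g k := by
    intro k
    rcases Nat.eq_zero_or_pos k with rfl | hk
    · rw [add_zero, hcf n le_rfl, fn, g0]
    · rw [hc]
      simp only
      rw [if_neg (by omega), Nat.add_sub_cancel_left]
  refine ⟨n + m, c, ⟨by rw [hcf 0 (Nat.zero_le n), f0], by rw [hcg, gm], ?_, ?_⟩, ?_⟩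
  · intro k hk
    rcases le_total k n with h | h
    · rw [hcf k h]
      exact fmem k h
    · obtain ⟨j, rfl⟩ := Nat.exists_eq_add_of_le h
      rw [hcg]
      exact gmem j (by omega)
  · intro k hk
    rcases lt_or_ge k n with h | h
    · rw [hcf k h.le, hcf (k + 1) h]
      exact flink k h
    · obtain ⟨j, rfl⟩ := Nat.exists_eq_add_of_le h
      rw [add_assoc, hcg, hcg]
      exact glink j (by omega)
  · rw [Finset.sum_range_add]
    congr 1
    · refine Finset.sum_congr rfl fun k hk => ?_
      have hk := Finset.mem_range.1 hk
      rw [hcf k hk.le, hcf (k + 1) hk]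
    · refine Finset.sum_congr rfl fun k _ => ?_
      rw [add_assoc, hcg, hcg]

lemma KM_nonneg {t : ℝ} (ht : 0 ≤ t) (x y : X) : 0 ≤ P.KM t x y :=
  Real.sInf_nonneg fun _ hs => P.nonneg_of_mem_chainCosts ht hs

lemma KM_symm (t : ℝ) (x y : X) : P.KM t x y = P.KM t y x :=
  congrArg sInf ((P.chainCosts_symm_subset t x y).antisymm (P.chainCosts_symm_subset t y x))

lemma KM_le_hFun {t : ℝ} (ht : 0 ≤ t) {x y : X} (h : P.Linked x y) :
    P.KM t x y ≤ P.hFun t x y :=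
  csInf_le (P.chainCosts_bddBelow ht x y) (P.hFun_mem_chainCosts t h)

lemma KM_self {t : ℝ} (ht : 0 ≤ t) {x : X} (hx : x ∈ P.X0 ∩ P.X1) : P.KM t x x = 0 := by
  refine ((P.KM_le_hFun ht (Or.inl ⟨hx.1, hx.1⟩)).trans_eq ?_).antisymm (P.KM_nonneg ht x x)
  simp [hFun, hx.1, hx.2, P.met0.refl x hx.1, P.met1.refl x hx.2]

lemma KM_triangle {t : ℝ} (ht : 0 ≤ t) {x y z : X} (hx : x ∈ P.X0 ∩ P.X1)
    (hy : y ∈ P.X0 ∩ P.X1) (hz : z ∈ P.X0 ∩ P.X1) :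
    P.KM t x z ≤ P.KM t x y + P.KM t y z := by
  have hxy : (P.chainCosts t x y).Nonempty :=
    ⟨_, P.hFun_mem_chainCosts t (Or.inl ⟨hx.1, hy.1⟩)⟩
  have hyz : (P.chainCosts t y z).Nonempty :=
    ⟨_, P.hFun_mem_chainCosts t (Or.inl ⟨hy.1, hz.1⟩)⟩
  rw [← sub_le_iff_le_add]
  refine le_csInf hxy fun a ha => ?_
  rw [sub_le_comm]
  refine le_csInf hyz fun b hb => ?_
  rw [sub_le_iff_le_add']
  exact csInf_le (P.chainCosts_bddBelow ht x z) (P.add_mem_chainCosts ha hb)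

lemma KM_le_sum {t : ℝ} (ht : 0 ≤ t) {S : ℤ → X} (hS : ∀ k, S k ∈ P.X0 ∩ P.X1) (a : ℤ) (n : ℕ) :
    P.KM t (S a) (S (a + n)) ≤ ∑ i ∈ Finset.range n, P.KM t (S (a + i)) (S (a + i + 1)) := by
  induction n with
  | zero => simp [P.KM_self ht (hS a)]
  | succ n ih =>
    rw [Finset.sum_range_succ, Nat.cast_succ, ← add_assoc]
    exact (P.KM_triangle ht (hS _) (hS (a + n)) (hS _)).trans (by gcongr)

lemma JM_nonneg (t : ℝ) {x y : X} (hx : x ∈ P.X0) (hy : y ∈ P.X0) : 0 ≤ P.JM t x y :=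
  (P.d0_nonneg hx hy).trans (le_max_left _ _)

lemma KM_one_le_min_mul_JM {t : ℝ} (ht : 0 < t) {x y : X} (hx : x ∈ P.X0 ∩ P.X1)
    (hy : y ∈ P.X0 ∩ P.X1) : P.KM 1 x y ≤ min 1 t⁻¹ * P.JM t x y := by
  refine (P.KM_le_hFun zero_le_one (Or.inl ⟨hx.1, hy.1⟩)).trans ?_
  rw [hFun, if_pos ⟨hx, hy⟩, one_mul, min_mul_of_nonneg _ _ (P.JM_nonneg t hx.1 hy.1), one_mul]
  refine min_le_min (le_max_left _ _) ?_
  rw [le_inv_mul_iff₀ ht]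
  exact le_max_right _ _

lemma linkSeq_mem {Y : Type*} {u v : ℕ → Y} {A : Set Y} (hu : ∀ n, u n ∈ A) (hv : ∀ n, v n ∈ A)
    (k : ℤ) : linkSeq u v k ∈ A := by
  unfold linkSeq
  split_ifs
  exacts [hu _, hv _]

lemma isApproxSeq_const {x : X} (hx : x ∈ P.X0 ∩ P.X1) : P.IsApproxSeq x fun _ => x := by
  refine ⟨fun _ => hx, fun ε hε => ⟨0, fun _ _ _ _ => ?_⟩, ?_⟩
  · simpa [JM, P.met0.refl x hx.1, P.met1.refl x hx.2] using hε
  · simp [P.KM_self zero_le_one hx]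

end CompatiblePair

/-- The `ℓ^p` norm of a bi-infinite sequence in `[0,∞]`. -/
noncomputable def ellNorm (p : ℝ≥0∞) (a : ℤ → ℝ≥0∞) : ℝ≥0∞ :=
  if p = ∞ then ⨆ k : ℤ, a k else (∑' k : ℤ, a k ^ p.toReal) ^ (1 / p.toReal)

lemma ellNorm_top (a : ℤ → ℝ≥0∞) : ellNorm ∞ a = ⨆ k, a k := if_pos rfl

lemma ellNorm_one (a : ℤ → ℝ≥0∞) : ellNorm 1 a = ∑' k, a k := by
  simp [ellNorm]

lemma sum_mul_le_ellNorm_mul_ellNorm {p q : ℝ≥0∞} (hpq : 1 / p + 1 / q = 1) (a b : ℤ → ℝ≥0∞)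
    (s : Finset ℤ) : ∑ k ∈ s, a k * b k ≤ ellNorm p a * ellNorm q b := by
  rcases eq_or_ne p ∞ with rfl | hp
  · obtain rfl : q = 1 := by simpa using hpq
    rw [ellNorm_top, ellNorm_one]
    calc ∑ k ∈ s, a k * b k ≤ ∑ k ∈ s, (⨆ j, a j) * b k := by
          gcongr with k
          exact le_iSup a k
      _ = (⨆ j, a j) * ∑ k ∈ s, b k := by rw [Finset.mul_sum]
      _ ≤ _ := by
          gcongr
          exact ENNReal.sum_le_tsum s
  rcases eq_or_ne q ∞ with rfl | hq
  · obtain rfl : p = 1 := by simpa using hpq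
    rw [ellNorm_top, ellNorm_one]
    calc ∑ k ∈ s, a k * b k ≤ ∑ k ∈ s, a k * (⨆ j, b j) := by
          gcongr with k
          exact le_iSup b k
      _ = (∑ k ∈ s, a k) * ⨆ j, b j := by rw [Finset.sum_mul]
      _ ≤ _ := by
          gcongr
          exact ENNReal.sum_le_tsum s
  have hp0 : p ≠ 0 := by
    rintro rfl
    simp at hpq
  have hq0 : q ≠ 0 := by
    rintro rfl
    simp at hpq
  have : ENNReal.HolderTriple p q 1 := ⟨by simpa using hpq⟩
  have hconj : p.toReal.HolderConjugate q.toReal := by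
    simpa using ENNReal.HolderTriple.toReal (p := p) (q := q) 1
      (ENNReal.toReal_pos hp0 hp) (ENNReal.toReal_pos hq0 hq)
  rw [ellNorm, ellNorm, if_neg hp, if_neg hq]
  refine (ENNReal.inner_le_Lp_mul_Lq s a b hconj).trans ?_
  gcongr <;> exact ENNReal.sum_le_tsum s

lemma ellNorm_ne_top_of_tsum_ne_top {p : ℝ≥0∞} (hp : 1 ≤ p) {a : ℤ → ℝ≥0∞}
    (ha1 : ∀ k, a k ≤ 1) (ha : ∑' k, a k ≠ ∞) : ellNorm p a ≠ ∞ := by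
  rcases eq_or_ne p ∞ with rfl | hpt
  · rw [ellNorm_top]
    exact ((iSup_le ha1).trans_lt ENNReal.one_lt_top).ne
  · rw [ellNorm, if_neg hpt]
    have hp' : 1 ≤ p.toReal := by simpa using ENNReal.toReal_mono hpt hp
    refine ENNReal.rpow_ne_top_of_nonneg (by positivity) (ne_top_of_le_ne_top ha ?_)
    exact ENNReal.tsum_le_tsum fun k => ENNReal.rpow_le_self_of_le_one (ha1 k) hp'

lemma ellNorm_ne_zero {p : ℝ≥0∞} (hp : p ≠ 0) {a : ℤ → ℝ≥0∞} {k : ℤ} (hk : a k ≠ 0) :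
    ellNorm p a ≠ 0 := by
  rcases eq_or_ne p ∞ with rfl | hpt
  · rw [ellNorm_top]
    exact fun h => hk (ENNReal.iSup_eq_zero.1 h k)
  · rw [ellNorm, if_neg hpt]
    have hp' := ENNReal.toReal_pos hp hpt
    intro h
    rw [ENNReal.rpow_eq_zero_iff_of_pos (by positivity), ENNReal.tsum_eq_zero] at h
    exact hk ((ENNReal.rpow_eq_zero_iff_of_pos hp').1 (h k))

lemma ellNorm_ne_top_of_support_subset_singleton {q : ℝ≥0∞} (hq : q ≠ 0) {a : ℤ → ℝ≥0∞} {j : ℤ}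
    (haj : a j ≠ ∞) (ha : ∀ k ≠ j, a k = 0) : ellNorm q a ≠ ∞ := by
  rcases eq_or_ne q ∞ with rfl | hqt
  · rw [ellNorm_top]
    refine ne_top_of_le_ne_top haj (iSup_le fun k => ?_)
    rcases eq_or_ne k j with rfl | hk
    · rfl
    · simp [ha k hk]
  · have hq' := ENNReal.toReal_pos hq hqt
    rw [ellNorm, if_neg hqt,
      tsum_eq_single j fun k hk => by rw [ha k hk, ENNReal.zero_rpow_of_pos hq']]
    exact ENNReal.rpow_ne_top_of_nonneg (by positivity)
      (ENNReal.rpow_ne_top_of_nonneg hq'.le haj)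

/-- The weight `2^{jθ} min{1, 2^{-j}}`. -/
noncomputable def minWeight (θ : ℝ) (j : ℤ) : ℝ :=
  (2 : ℝ) ^ ((j : ℝ) * θ) * min 1 ((2 : ℝ) ^ (-(j : ℝ)))

lemma minWeight_pos (θ : ℝ) (j : ℤ) : 0 < minWeight θ j := by
  unfold minWeight
  positivity

lemma minWeight_le_left (θ : ℝ) (j : ℤ) : minWeight θ j ≤ (2 : ℝ) ^ ((j : ℝ) * θ) :=
  mul_le_of_le_one_right (by positivity) (min_le_left _ _)

lemma minWeight_le_right (θ : ℝ) (j : ℤ) : minWeight θ j ≤ (2 : ℝ) ^ ((j : ℝ) * (θ - 1)) := by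
  rw [mul_sub, mul_one, sub_eq_add_neg, Real.rpow_add two_pos]
  exact mul_le_mul_of_nonneg_left (min_le_right _ _) (by positivity)

lemma minWeight_le_one {θ : ℝ} (hθ : θ ∈ Set.Ioo (0 : ℝ) 1) (j : ℤ) : minWeight θ j ≤ 1 := by
  rcases le_total (j : ℝ) 0 with hj | hj
  · exact (minWeight_le_left θ j).trans
      (Real.rpow_le_one_of_one_le_of_nonpos one_le_two (mul_nonpos_of_nonpos_of_nonneg hj hθ.1.le))
  · exact (minWeight_le_right θ j).trans (Real.rpow_le_one_of_one_le_of_nonpos one_le_two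
      (mul_nonpos_of_nonneg_of_nonpos hj (sub_nonpos.2 hθ.2.le)))

lemma summable_two_rpow_mul {c : ℝ} (hc : c < 0) :
    Summable fun n : ℕ => (2 : ℝ) ^ ((n : ℝ) * c) := by
  simp_rw [mul_comm _ c, Real.rpow_mul zero_le_two, Real.rpow_natCast]
  exact summable_geometric_of_lt_one (by positivity)
    (Real.rpow_lt_one_of_one_lt_of_neg one_lt_two hc)

lemma summable_minWeight {θ : ℝ} (hθ : θ ∈ Set.Ioo (0 : ℝ) 1) : Summable (minWeight θ) := by
  refine Summable.of_nat_of_neg ?_ ?_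
  · refine Summable.of_nonneg_of_le (fun n => (minWeight_pos θ n).le)
      (fun n => minWeight_le_right θ n) ?_
    simpa using summable_two_rpow_mul (sub_neg.2 hθ.2)
  · refine Summable.of_nonneg_of_le (fun n => (minWeight_pos θ _).le)
      (fun n => minWeight_le_left θ _) ?_
    simpa using summable_two_rpow_mul (neg_lt_zero.2 hθ.1)

lemma ellNorm_minWeight_ne_top {θ : ℝ} (hθ : θ ∈ Set.Ioo (0 : ℝ) 1) {p : ℝ≥0∞} (hp : 1 ≤ p) :
    ellNorm p (fun j => ENNReal.ofReal (minWeight θ j)) ≠ ∞ :=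
  ellNorm_ne_top_of_tsum_ne_top hp (fun j => ENNReal.ofReal_le_one.2 (minWeight_le_one hθ j))
    (summable_minWeight hθ).tsum_ofReal_ne_top

lemma MConst'_eq (θ : ℝ) (p : ℝ≥0∞) :
    MConst' θ p = (ellNorm p fun j => ENNReal.ofReal (minWeight θ j)).toReal := rfl

lemma GammaE_eq (θ : ℝ) (q : ℝ≥0∞) (x : ℤ → ℝ) :
    GammaE θ q x = ellNorm q fun k => ENNReal.ofReal ((2 : ℝ) ^ (-(k : ℝ) * θ) * |x k|) := rfl

lemma sum_ofReal_min_mul_le (θ : ℝ) {p q : ℝ≥0∞} (hpq : 1 / p + 1 / q = 1) (x : ℤ → ℝ)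
    (s : Finset ℤ) :
    ∑ k ∈ s, ENNReal.ofReal (min 1 ((2 : ℝ) ^ k)⁻¹ * |x k|) ≤
      ellNorm p (fun j => ENNReal.ofReal (minWeight θ j)) * GammaE θ q x := by
  refine le_trans (Finset.sum_le_sum fun k _ => le_of_eq ?_)
    (sum_mul_le_ellNorm_mul_ellNorm hpq _ _ s)
  rw [← ENNReal.ofReal_mul (minWeight_pos θ k).le, minWeight, neg_mul, Real.rpow_neg zero_le_two,
    Real.rpow_neg zero_le_two, Real.rpow_intCast]
  congr 1
  have : (2 : ℝ) ^ ((k : ℝ) * θ) ≠ 0 := by positivity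
  field_simp

namespace CompatiblePair

variable {X : Type*} [MetricSpace X] (P : CompatiblePair X)

lemma pFunE_ne_top (θ : ℝ) {q : ℝ≥0∞} (hq : q ≠ 0) {x y : X} (hx : x ∈ P.X0 ∩ P.X1)
    (hy : y ∈ P.X0 ∩ P.X1) : P.pFunE θ q x y ≠ ∞ := by
  refine ne_top_of_le_ne_top ?_ (iInf_le_of_le (fun _ => x) (iInf_le_of_le (fun _ => y)
    (iInf_le_of_le (P.isApproxSeq_const hx) (iInf_le _ (P.isApproxSeq_const hy)))))
  rw [GammaE_eq]
  refine ellNorm_ne_top_of_support_subset_singleton hq (j := -1) ENNReal.ofReal_ne_top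
    fun k hk => ?_
  rcases le_or_gt 0 k with h | h
  · have h' : 0 ≤ k + 1 := by omega
    simp [linkSeq, h, h', JM, P.met0.refl x hx.1, P.met1.refl x hx.2]
  · have h' : ¬ 0 ≤ k + 1 := by omega
    simp [linkSeq, h.not_ge, h', JM, P.met0.refl y hy.1, P.met1.refl y hy.2]

lemma ofReal_KM_linkSeq_le (θ : ℝ) {p q : ℝ≥0∞} (hpq : 1 / p + 1 / q = 1) {S : ℤ → X}
    (hS : ∀ k, S k ∈ P.X0 ∩ P.X1) (a : ℤ) (n : ℕ) :
    ENNReal.ofReal (P.KM 1 (S a) (S (a + n))) ≤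
      ellNorm p (fun j => ENNReal.ofReal (minWeight θ j)) *
        GammaE θ q (fun k : ℤ => P.JM ((2 : ℝ) ^ k) (S k) (S (k + 1))) := by
  let e : ℕ ↪ ℤ := ⟨fun i => a + i, fun i j h => by simpa using h⟩
  refine le_trans ?_ (sum_ofReal_min_mul_le θ hpq _ ((Finset.range n).map e))
  rw [Finset.sum_map]
  refine (ENNReal.ofReal_le_ofReal (P.KM_le_sum zero_le_one hS a n)).trans ?_
  rw [ENNReal.ofReal_sum_of_nonneg fun i _ => P.KM_nonneg zero_le_one _ _]
  refine Finset.sum_le_sum fun i _ => ENNReal.ofReal_le_ofReal ?_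
  rw [abs_of_nonneg (P.JM_nonneg _ (hS _).1 (hS _).1)]
  exact P.KM_one_le_min_mul_JM (by positivity) (hS _) (hS _)

lemma ofReal_KM_one_le_mul_GammaE (θ : ℝ) {p q : ℝ≥0∞} (hpq : 1 / p + 1 / q = 1) {x y : X}
    (hx : x ∈ P.X0 ∩ P.X1) (hy : y ∈ P.X0 ∩ P.X1) {u v : ℕ → X} (hu : P.IsApproxSeq x u)
    (hv : P.IsApproxSeq y v) :
    ENNReal.ofReal (P.KM 1 x y) ≤ ellNorm p (fun j => ENNReal.ofReal (minWeight θ j)) *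
      GammaE θ q (fun k : ℤ =>
        P.JM ((2 : ℝ) ^ k) (linkSeq u v k) (linkSeq u v (k + 1))) := by
  set B := ellNorm p (fun j => ENNReal.ofReal (minWeight θ j)) *
      GammaE θ q (fun k : ℤ => P.JM ((2 : ℝ) ^ k) (linkSeq u v k) (linkSeq u v (k + 1)))
  have hlim : Filter.Tendsto (fun n => ENNReal.ofReal (P.KM 1 (v n) y) + B +
      ENNReal.ofReal (P.KM 1 (u n) x)) Filter.atTop (nhds B) := by
    simpa using ((ENNReal.tendsto_ofReal hv.2.2).add_const B).add (ENNReal.tendsto_ofReal hu.2.2)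
  refine ge_of_tendsto hlim ((Filter.eventually_ge_atTop 1).mono fun n hn => ?_)
  have hmid := P.ofReal_KM_linkSeq_le θ hpq (linkSeq_mem hu.1 hv.1) (-(n : ℤ)) (2 * n)
  have hleft : linkSeq u v (-(n : ℤ)) = v n := by
    simp [linkSeq, show n ≠ 0 by omega]
  have hright : linkSeq u v (-(n : ℤ) + (2 * n : ℕ)) = u n := by
    rw [show -(n : ℤ) + (2 * n : ℕ) = n by push_cast; ring]
    simp [linkSeq]
  rw [hleft, hright] at hmid
  calc ENNReal.ofReal (P.KM 1 x y)
      ≤ ENNReal.ofReal (P.KM 1 (v n) y + P.KM 1 (v n) (u n) + P.KM 1 (u n) x) := by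
        refine ENNReal.ofReal_le_ofReal ?_
        rw [P.KM_symm 1 x y, P.KM_symm 1 (v n) y]
        have h₁ := P.KM_triangle zero_le_one hy (hu.1 n) hx
        have h₂ := P.KM_triangle zero_le_one hy (hv.1 n) (hu.1 n)
        linarith
    _ ≤ ENNReal.ofReal (P.KM 1 (v n) y) + ENNReal.ofReal (P.KM 1 (v n) (u n)) +
          ENNReal.ofReal (P.KM 1 (u n) x) :=
        ENNReal.ofReal_add_le.trans (by gcongr; exact ENNReal.ofReal_add_le)
    _ ≤ _ := by gcongr

end CompatiblePair

/-- `K_M(1; x, y) ≤ M'_{θ,q} · p_{θ,q}(x, y)` on `X₀ ∩ X₁`, where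
`M'_{θ,q} = (∑_j (2^{jθ} min{1,2^{-j}})^p)^{1/p}` (`p` the conjugate exponent of `q`)
is a finite positive constant. -/
theorem KM_one_le_MConst'_mul_pFun {X : Type*} [MetricSpace X] (P : CompatiblePair X)
    (θ : ℝ) (hθ : θ ∈ Set.Ioo (0 : ℝ) 1) (q p : ℝ≥0∞) (hq : 1 ≤ q)
    (hpq : 1 / p + 1 / q = 1) :
    0 < MConst' θ p ∧
      ∀ x ∈ P.X0 ∩ P.X1, ∀ y ∈ P.X0 ∩ P.X1,
        P.KM 1 x y ≤ MConst' θ p * P.pFun θ q x y := by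
  have hp : 1 ≤ p := by
    rw [← ENNReal.inv_le_one, ← one_div]
    exact le_self_add.trans_eq hpq
  have hp0 : p ≠ 0 := (zero_lt_one.trans_le hp).ne'
  have hM := ellNorm_minWeight_ne_top hθ hp
  have hM0 : ellNorm p (fun j => ENNReal.ofReal (minWeight θ j)) ≠ 0 :=
    ellNorm_ne_zero hp0 (k := 0) (by simpa using minWeight_pos θ 0)
  refine ⟨ENNReal.toReal_pos hM0 hM, fun x hx y hy => ?_⟩
  have hfin := P.pFunE_ne_top θ (zero_lt_one.trans_le hq).ne' hx hy
  rw [MConst'_eq, CompatiblePair.pFun, ← ENNReal.toReal_mul,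
    ← ENNReal.ofReal_le_iff_le_toReal (ENNReal.mul_ne_top hM hfin),
    ← ENNReal.div_le_iff' hM0 hM]
  refine le_iInf fun u => le_iInf fun v => le_iInf fun hu => le_iInf fun hv => ?_
  rw [ENNReal.div_le_iff' hM0 hM]
  exact P.ofReal_KM_one_le_mul_GammaE θ hpq hx hy hu hv
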